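/- Let (A^{p,q}, d', d'') be a totally bounded double complex of complex vector spaces. Suppose that for every (p,q) ∈ ℤ² the space H_{BC}^{p,q} is finite dimensional, that for every k ∈ ℤ the space H^k is finite dimensional, and that Σ_{p+q=k} dim_ℂ H_{BC}^{p,q} = dim_ℂ H^k for every k. Then the double complex satisfies the d'd''-lemma, i.e., for every (p,q): Im d' ∩ ker d'' ∩ A^{p,q} = ker d' ∩ Im d'' ∩ A^{p,q} = Im d'd'' ∩ A^{p,q}. -/

import Mathlib

open Submodule

/-- A double complex of complex vector spaces, realized as an internally bigraded
module `W = ⊕_{p,q} A p q` together with global differentials `d'`, `d''` of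
bidegrees `(1,0)` and `(0,1)` satisfying `d'∘d' = 0`, `d''∘d'' = 0` and
`d'∘d'' + d''∘d' = 0`. -/
structure BiComplex (W : Type*) [AddCommGroup W] [Module ℂ W] where
  A : ℤ → ℤ → Submodule ℂ W
  d' : W →ₗ[ℂ] W
  d'' : W →ₗ[ℂ] W
  internal : DirectSum.IsInternal (fun pq : ℤ × ℤ => A pq.1 pq.2)
  map_d' : ∀ p q : ℤ, (A p q).map d' ≤ A (p + 1) q
  map_d'' : ∀ p q : ℤ, (A p q).map d'' ≤ A p (q + 1)
  d'_sq : d' ∘ₗ d' = 0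
  d''_sq : d'' ∘ₗ d'' = 0
  anticomm : d' ∘ₗ d'' + d'' ∘ₗ d' = 0

namespace BiComplex

variable {W : Type*} [AddCommGroup W] [Module ℂ W] (C : BiComplex W)

/-- `ker d' ∩ A^{p,q}` : the kernel of `d' : A^{p,q} → A^{p+1,q}`. -/
def kerd' (p q : ℤ) : Submodule ℂ W := LinearMap.ker C.d' ⊓ C.A p q

/-- `ker d'' ∩ A^{p,q}` : the kernel of `d'' : A^{p,q} → A^{p,q+1}`. -/
def kerd'' (p q : ℤ) : Submodule ℂ W := LinearMap.ker C.d'' ⊓ C.A p q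

/-- `Im d' ∩ A^{p,q} = d'(A^{p-1,q})`. -/
def imd' (p q : ℤ) : Submodule ℂ W := (C.A (p - 1) q).map C.d'

/-- `Im d'' ∩ A^{p,q} = d''(A^{p,q-1})`. -/
def imd'' (p q : ℤ) : Submodule ℂ W := (C.A p (q - 1)).map C.d''

/-- `Im d'd'' ∩ A^{p,q} = (d'∘d'')(A^{p-1,q-1})`. -/
def imd'd'' (p q : ℤ) : Submodule ℂ W := (C.A (p - 1) (q - 1)).map (C.d' ∘ₗ C.d'')

/-- `ker d'd'' ∩ A^{p,q}` : the kernel of `d'∘d'' : A^{p,q} → A^{p+1,q+1}`. -/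
def kerd'd'' (p q : ℤ) : Submodule ℂ W := LinearMap.ker (C.d' ∘ₗ C.d'') ⊓ C.A p q

/-- The `d'd''`-lemma at `(p,q)`:
`Im d' ∩ ker d'' ∩ A^{p,q} = ker d' ∩ Im d'' ∩ A^{p,q} = Im d'd'' ∩ A^{p,q}`. -/
def DDLemmaAt (p q : ℤ) : Prop :=
  C.imd' p q ⊓ C.kerd'' p q = C.imd'd'' p q ∧ C.kerd' p q ⊓ C.imd'' p q = C.imd'd'' p q

/-- The total-degree piece `A^k = ⊕_{p+q=k} A^{p,q}`. -/
def Atot (k : ℤ) : Submodule ℂ W := ⨆ p : ℤ, C.A p (k - p)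

/-- The total differential `d = d' + d''`. -/
def dtot : W →ₗ[ℂ] W := C.d' + C.d''

/-- `ker d ∩ A^k` : the kernel of `d : A^k → A^{k+1}`. -/
def kerdTot (k : ℤ) : Submodule ℂ W := LinearMap.ker C.dtot ⊓ C.Atot k

/-- `Im d ∩ A^k = d(A^{k-1})`. -/
def imdTot (k : ℤ) : Submodule ℂ W := (C.Atot (k - 1)).map C.dtot

/-- `ker d' ∩ ker d'' ∩ A^k = ⊕_{p+q=k} (ker d' ∩ ker d'' ∩ A^{p,q})`. -/
def kerd'kerd''Tot (k : ℤ) : Submodule ℂ W :=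
  ⨆ p : ℤ, (C.kerd' p (k - p) ⊓ C.kerd'' p (k - p))

/-- `Im d'd'' ∩ A^k = ⊕_{p+q=k} (Im d'd'' ∩ A^{p,q})`. -/
def imd'd''Tot (k : ℤ) : Submodule ℂ W := ⨆ p : ℤ, C.imd'd'' p (k - p)

/-- `ker d'd'' ∩ A^k = ⊕_{p+q=k} (ker d'd'' ∩ A^{p,q})`. -/
def kerd'd''Tot (k : ℤ) : Submodule ℂ W := ⨆ p : ℤ, C.kerd'd'' p (k - p)

/-- `Im d' ∩ A^k = ⊕_{p+q=k} (Im d' ∩ A^{p,q})`. -/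
def imd'Tot (k : ℤ) : Submodule ℂ W := ⨆ p : ℤ, C.imd' p (k - p)

/-- `Im d'' ∩ A^k = ⊕_{p+q=k} (Im d'' ∩ A^{p,q})`. -/
def imd''Tot (k : ℤ) : Submodule ℂ W := ⨆ p : ℤ, C.imd'' p (k - p)

/-- The double complex is totally bounded: `A^{p,q} = 0` for `|p| > N` or `|q| > N`. -/
def TotallyBounded : Prop :=
  ∃ N : ℕ, ∀ p q : ℤ, ((N : ℤ) < |p| ∨ (N : ℤ) < |q|) → C.A p q = ⊥

end BiComplex

/-- The quotient vector space `S / T` of a submodule `S` by (the trace of) a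
submodule `T ≤ S`. -/
abbrev quotSub {W : Type*} [AddCommGroup W] [Module ℂ W] (S T : Submodule ℂ W) :=
  S ⧸ (Submodule.comap S.subtype T)

namespace BiComplex

variable {W : Type*} [AddCommGroup W] [Module ℂ W] (C : BiComplex W)

theorem d'_d' (x : W) : C.d' (C.d' x) = 0 := LinearMap.congr_fun C.d'_sq x

theorem d''_d'' (x : W) : C.d'' (C.d'' x) = 0 := LinearMap.congr_fun C.d''_sq x

theorem d''_d' (x : W) : C.d'' (C.d' x) = -C.d' (C.d'' x) :=
  eq_neg_of_add_eq_zero_right (LinearMap.congr_fun C.anticomm x)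

theorem dtot_apply (x : W) : C.dtot x = C.d' x + C.d'' x := rfl

theorem dtot_dtot (x : W) : C.dtot (C.dtot x) = 0 := by
  simp [dtot_apply, d'_d', d''_d'', d''_d']

theorem d'_mem {p q : ℤ} {x : W} (hx : x ∈ C.A p q) : C.d' x ∈ C.A (p + 1) q :=
  C.map_d' p q (mem_map_of_mem hx)

theorem d''_mem {p q : ℤ} {x : W} (hx : x ∈ C.A p q) : C.d'' x ∈ C.A p (q + 1) :=
  C.map_d'' p q (mem_map_of_mem hx)

theorem mem_Atot {p q k : ℤ} (hk : p + q = k) {x : W} (hx : x ∈ C.A p q) : x ∈ C.Atot k := by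
  obtain rfl : q = k - p := by omega
  exact mem_iSup_of_mem (p := fun p => C.A p (k - p)) p hx

variable {C} in
@[elab_as_elim]
theorem Atot_induction {k : ℤ} {motive : ∀ x, x ∈ C.Atot k → Prop}
    (mem : ∀ p q (h : p + q = k) x (hx : x ∈ C.A p q), motive x (C.mem_Atot h hx))
    (zero : motive 0 (zero_mem _))
    (add : ∀ x y hx hy, motive x hx → motive y hy → motive (x + y) (add_mem hx hy))
    {x : W} (hx : x ∈ C.Atot k) : motive x hx :=
  iSup_induction' _ (fun p x hx => mem p (k - p) (by omega) x hx) zero add hx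

theorem d'_mem_Atot {k : ℤ} {x : W} (hx : x ∈ C.Atot k) : C.d' x ∈ C.Atot (k + 1) := by
  induction hx using Atot_induction with
  | mem p q h x hx => exact C.mem_Atot (by omega) (C.d'_mem hx)
  | zero => simp
  | add x y _ _ hx hy => rw [map_add]; exact add_mem hx hy

theorem d''_mem_Atot {k : ℤ} {x : W} (hx : x ∈ C.Atot k) : C.d'' x ∈ C.Atot (k + 1) := by
  induction hx using Atot_induction with
  | mem p q h x hx => exact C.mem_Atot (by omega) (C.d''_mem hx)
  | zero => simp
  | add x y _ _ hx hy => rw [map_add]; exact add_mem hx hy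

theorem dtot_mem_imdTot {k l : ℤ} (hkl : l + 1 = k) {x : W} (hx : x ∈ C.Atot l) :
    C.dtot x ∈ C.imdTot k := by
  obtain rfl : l = k - 1 := by omega
  exact mem_map_of_mem hx

theorem imdTot_le_kerdTot (k : ℤ) : C.imdTot k ≤ C.kerdTot k := by
  rintro _ ⟨x, hx, rfl⟩
  refine ⟨C.dtot_dtot x, ?_⟩
  have h := add_mem (C.d'_mem_Atot hx) (C.d''_mem_Atot hx)
  rwa [sub_add_cancel] at h

/-- The operator multiplying `A^{p,q}` by `p`. -/
noncomputable def euler : W →ₗ[ℂ] W :=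
  DirectSum.toModule ℂ (ℤ × ℤ) W (fun pq => (pq.1 : ℂ) • (C.A pq.1 pq.2).subtype) ∘ₗ
    (LinearEquiv.ofBijective (DirectSum.coeLinearMap fun pq : ℤ × ℤ => C.A pq.1 pq.2)
      C.internal).symm.toLinearMap

theorem euler_apply {p q : ℤ} {x : W} (hx : x ∈ C.A p q) : C.euler x = (p : ℂ) • x := by
  have h : (LinearEquiv.ofBijective (DirectSum.coeLinearMap fun pq : ℤ × ℤ => C.A pq.1 pq.2)
      C.internal).symm x =
      DirectSum.lof ℂ (ℤ × ℤ) (fun pq => C.A pq.1 pq.2) (p, q) ⟨x, hx⟩ := by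
    rw [LinearEquiv.symm_apply_eq]
    exact (DirectSum.coeLinearMap_lof (fun pq : ℤ × ℤ => C.A pq.1 pq.2) (p, q) ⟨x, hx⟩).symm
  simp only [euler, LinearMap.comp_apply, LinearEquiv.coe_coe, h, DirectSum.toModule_lof]
  rfl

theorem euler_mem_Atot {k : ℤ} {x : W} (hx : x ∈ C.Atot k) : C.euler x ∈ C.Atot k := by
  induction hx using Atot_induction with
  | mem p q h x hx =>
    rw [C.euler_apply hx]
    exact smul_mem _ _ (C.mem_Atot h hx)
  | zero => simp
  | add x y _ _ hx hy => rw [map_add]; exact add_mem hx hy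

theorem dtot_euler {k : ℤ} {x : W} (hx : x ∈ C.Atot k) :
    C.dtot (C.euler x) = C.euler (C.dtot x) - C.d' x := by
  induction hx using Atot_induction with
  | mem p q h x hx =>
    rw [C.euler_apply hx, dtot_apply, dtot_apply, map_add, C.euler_apply (C.d'_mem hx),
      C.euler_apply (C.d''_mem hx), map_smul, map_smul]
    push_cast
    module
  | zero => simp
  | add x y _ _ hx hy => simp only [map_add, hx, hy]; abel

/-- If `z` is closed for the total differential, then `d'z` is exact for it. -/
theorem d'_mem_imdTot {k : ℤ} {z : W} (hz : z ∈ C.kerdTot k) : C.d' z ∈ C.imdTot (k + 1) := by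
  have h := C.dtot_euler hz.2
  rw [show C.dtot z = 0 from hz.1, map_zero, zero_sub] at h
  rw [← neg_neg (C.d' z), ← h]
  exact neg_mem (C.dtot_mem_imdTot rfl (C.euler_mem_Atot hz.2))

/-- If a linear map sends distinct bigraded pieces `A^{p,k-p}` to distinct bigraded pieces,
then it annihilates the components of any element of its kernel. -/
theorem map_component_eq_zero {k : ℤ} (D : W →ₗ[ℂ] W) (σ : ℤ → ℤ × ℤ)
    (hσ : Function.Injective σ) (hD : ∀ p, ∀ x ∈ C.A p (k - p), D x ∈ C.A (σ p).1 (σ p).2)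
    {f : ℤ →₀ W} (hf : ∀ p, f p ∈ C.A p (k - p)) (h0 : D (f.sum fun _ x => x) = 0) (p : ℤ) :
    D (f p) = 0 := by
  by_cases hp : p ∈ f.support
  · refine (iSupIndep_iff_finsetSum_eq_zero_imp_eq_zero _).1
      (C.internal.submodule_iSupIndep.comp hσ) f.support (fun p => D (f p))
      (fun p _ => hD p _ (hf p)) ?_ p hp
    rw [← map_sum]
    exact h0
  · rw [Finsupp.notMem_support_iff.1 hp, map_zero]

theorem exists_finsupp_of_mem_Atot {k : ℤ} {x : W} (hx : x ∈ C.Atot k) (h' : C.d' x = 0)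
    (hd'' : C.d'' x = 0) :
    ∃ f : ℤ →₀ W, (∀ p, f p ∈ C.kerd' p (k - p) ⊓ C.kerd'' p (k - p)) ∧
      (f.sum fun _ x => x) = x := by
  obtain ⟨f, hf, rfl⟩ := (mem_iSup_iff_exists_finsupp _ _).1 hx
  refine ⟨f, fun p => ⟨⟨?_, hf p⟩, ⟨?_, hf p⟩⟩, rfl⟩
  · exact C.map_component_eq_zero C.d' (fun p => (p + 1, k - p))
      (fun a b h => by simpa using congrArg Prod.fst h) (fun p x hx => C.d'_mem hx) hf h' p
  · exact C.map_component_eq_zero C.d'' (fun p => (p, k - p + 1))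
      (fun a b h => by simpa using congrArg Prod.fst h) (fun p x hx => C.d''_mem hx) hf hd'' p

/-- Injectivity of `⊕_{p+q=k} H_BC^{p,q} → H^k`. -/
def BCInjective (k : ℤ) : Prop :=
  ∀ f : ℤ →₀ W, (∀ p, f p ∈ C.kerd' p (k - p) ⊓ C.kerd'' p (k - p)) →
    (f.sum fun _ x => x) ∈ C.imdTot k → ∀ p, f p ∈ C.imd'd'' p (k - p)

variable {C}

/-- Injectivity of `H_BC → H` in degree `k + 1` forces surjectivity in degree `k`. -/
theorem BCInjective.exists_sub_mem_imdTot {k : ℤ} (h : C.BCInjective (k + 1)) {z : W}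
    (hz : z ∈ C.kerdTot k) :
    ∃ f : ℤ →₀ W, (∀ p, f p ∈ C.kerd' p (k - p) ⊓ C.kerd'' p (k - p)) ∧
      z - (f.sum fun _ x => x) ∈ C.imdTot k := by
  have hz0 : C.d' z + C.d'' z = 0 := hz.1
  have hd''z : C.d'' z = -C.d' z := eq_neg_of_add_eq_zero_right hz0
  obtain ⟨g, hg, hgz⟩ := C.exists_finsupp_of_mem_Atot (C.d'_mem_Atot hz.2) (C.d'_d' z)
    (by rw [d''_d', hd''z, map_neg, d'_d', neg_zero, neg_zero])
  have hgI := h g hg (hgz ▸ C.d'_mem_imdTot hz)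
  choose u hu hug using hgI
  set v := ∑ p ∈ g.support, u p with hv
  have hvA : v ∈ C.Atot (k - 1) := sum_mem fun p _ => C.mem_Atot (by omega) (hu p)
  have hd'v : C.d' (C.d'' v) = C.d' z := by
    rw [hv, map_sum, map_sum, ← hgz]
    exact Finset.sum_congr rfl fun p _ => hug p
  have hdv : C.dtot v ∈ C.imdTot k := C.dtot_mem_imdTot (by omega) hvA
  obtain ⟨f, hf, hfz⟩ := C.exists_finsupp_of_mem_Atot (x := z - C.dtot v)
    (sub_mem hz.2 (C.imdTot_le_kerdTot k hdv).2)
    (by rw [map_sub, dtot_apply, map_add, d'_d', hd'v, zero_add, sub_self])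
    (by rw [map_sub, dtot_apply, map_add, d''_d'', d''_d', hd'v, hd''z, add_zero, sub_self])
  refine ⟨f, hf, ?_⟩
  rwa [hfz, sub_sub_cancel]

variable (C)

theorem kerd'_inf_kerd''_le_kerdTot (p k : ℤ) :
    C.kerd' p (k - p) ⊓ C.kerd'' p (k - p) ≤ C.kerdTot k := by
  rintro x ⟨⟨h', hA⟩, h'', -⟩
  refine ⟨?_, C.mem_Atot (by omega) hA⟩
  change C.d' x + C.d'' x = 0
  rw [show C.d' x = 0 from h', show C.d'' x = 0 from h'', add_zero]

theorem imd'd''_le_imdTot (p k : ℤ) : C.imd'd'' p (k - p) ≤ C.imdTot k := by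
  rintro _ ⟨u, hu, rfl⟩
  have h := C.dtot_mem_imdTot (k := k) (by omega) (C.mem_Atot rfl (C.d''_mem hu))
  rwa [dtot_apply, d''_d'', add_zero] at h

/-- The natural map `H_BC^{p,k-p} → H^k`. -/
def bcToTot (p k : ℤ) :
    quotSub (C.kerd' p (k - p) ⊓ C.kerd'' p (k - p)) (C.imd'd'' p (k - p)) →ₗ[ℂ]
      quotSub (C.kerdTot k) (C.imdTot k) :=
  mapQ _ _ (inclusion (C.kerd'_inf_kerd''_le_kerdTot p k))
    fun _ hx => C.imd'd''_le_imdTot p k hx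

/-- The natural map `⊕_{p ∈ S} H_BC^{p,k-p} → H^k`. -/
noncomputable def bcSumToTot (S : Finset ℤ) (k : ℤ) :
    (∀ p : S, quotSub (C.kerd' p (k - p) ⊓ C.kerd'' p (k - p)) (C.imd'd'' p (k - p))) →ₗ[ℂ]
      quotSub (C.kerdTot k) (C.imdTot k) :=
  ∑ p : S, C.bcToTot p k ∘ₗ LinearMap.proj p

theorem bcSumToTot_mk {S : Finset ℤ} {k : ℤ} {f : ℤ →₀ W}
    (hf : ∀ p, f p ∈ C.kerd' p (k - p) ⊓ C.kerd'' p (k - p)) (hS : f.support ⊆ S)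
    (hZ : (f.sum fun _ x => x) ∈ C.kerdTot k) :
    C.bcSumToTot S k (fun p => Submodule.Quotient.mk ⟨f p, hf p⟩) =
      Submodule.Quotient.mk ⟨f.sum fun _ x => x, hZ⟩ := by
  simp only [bcSumToTot, LinearMap.sum_apply, LinearMap.comp_apply, LinearMap.proj_apply,
    bcToTot, mapQ_apply]
  simp only [← mkQ_apply]
  rw [← map_sum]
  congr 1
  ext
  rw [AddSubmonoidClass.coe_finsetSum]
  exact (Finset.sum_coe_sort S f).trans
    (Finsupp.sum_of_support_subset f hS (fun _ x => x) fun _ _ => rfl).symm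

variable {C}

theorem BCInjective.of_succ {k : ℤ} {S : Finset ℤ} (hS : ∀ p ∉ S, C.A p (k - p) = ⊥)
    (hBCfin : ∀ p q : ℤ, FiniteDimensional ℂ
      (quotSub (C.kerd' p q ⊓ C.kerd'' p q) (C.imd'd'' p q)))
    (hHfin : FiniteDimensional ℂ (quotSub (C.kerdTot k) (C.imdTot k)))
    (heq : (∑ᶠ p : ℤ, Module.finrank ℂ
          (quotSub (C.kerd' p (k - p) ⊓ C.kerd'' p (k - p))
            (C.imd'd'' p (k - p)))) =
        Module.finrank ℂ (quotSub (C.kerdTot k) (C.imdTot k)))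
    (h : C.BCInjective (k + 1)) : C.BCInjective k := by
  have hK : ∀ p ∉ S, C.kerd' p (k - p) ⊓ C.kerd'' p (k - p) = ⊥ := fun p hp =>
    le_bot_iff.1 fun x hx => hS p hp ▸ hx.1.2
  have hsupp : ∀ f : ℤ →₀ W, (∀ p, f p ∈ C.kerd' p (k - p) ⊓ C.kerd'' p (k - p)) →
      f.support ⊆ S := fun f hf p hp => by
    by_contra hpS
    have h0 := hf p
    rw [hK p hpS, mem_bot] at h0
    exact Finsupp.mem_support_iff.1 hp h0
  have hsum : ∀ f : ℤ →₀ W, (∀ p, f p ∈ C.kerd' p (k - p) ⊓ C.kerd'' p (k - p)) →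
      (f.sum fun _ x => x) ∈ C.kerdTot k := fun f hf =>
    sum_mem fun p _ => C.kerd'_inf_kerd''_le_kerdTot p k (hf p)
  have hdim : Module.finrank ℂ
      (∀ p : S, quotSub (C.kerd' p (k - p) ⊓ C.kerd'' p (k - p)) (C.imd'd'' p (k - p))) =
      Module.finrank ℂ (quotSub (C.kerdTot k) (C.imdTot k)) := by
    rw [← heq, Module.finrank_pi_fintype, finsum_eq_sum_of_support_subset (s := S)]
    · exact Finset.sum_coe_sort S fun p => Module.finrank ℂ
        (quotSub (C.kerd' p (k - p) ⊓ C.kerd'' p (k - p)) (C.imd'd'' p (k - p)))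
    · intro p hp
      by_contra hpS
      refine hp ?_
      have : Subsingleton ↥(C.kerd' p (k - p) ⊓ C.kerd'' p (k - p)) :=
        (subsingleton_iff_eq_bot).2 (hK p hpS)
      exact Module.finrank_zero_of_subsingleton
  have hsurj : Function.Surjective (C.bcSumToTot S k) := by
    intro y
    obtain ⟨⟨z, hz⟩, rfl⟩ := Submodule.Quotient.mk_surjective _ y
    obtain ⟨f, hf, hfz⟩ := h.exists_sub_mem_imdTot hz
    refine ⟨_, (C.bcSumToTot_mk hf (hsupp f hf) (hsum f hf)).trans ?_⟩
    exact ((Submodule.Quotient.eq (comap (C.kerdTot k).subtype (C.imdTot k))).2 hfz).symm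
  have hinj := (LinearMap.injective_iff_surjective_of_finrank_eq_finrank hdim).2 hsurj
  intro f hf hfB p
  by_cases hp : p ∈ S
  · have h0 := (C.bcSumToTot_mk hf (hsupp f hf) (hsum f hf)).trans
      ((Submodule.Quotient.mk_eq_zero (comap (C.kerdTot k).subtype (C.imdTot k))).2 hfB)
    have h1 := congrFun (hinj (h0.trans (map_zero _).symm)) ⟨p, hp⟩
    exact (Submodule.Quotient.mk_eq_zero (comap
      (C.kerd' p (k - p) ⊓ C.kerd'' p (k - p)).subtype (C.imd'd'' p (k - p)))).1 h1
  · rw [Finsupp.notMem_support_iff.1 fun hp' => hp (hsupp f hf hp')]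
    exact zero_mem _

/-- If `H_BC → H` is injective, `a ∈ A^{p,q}` and `d'd''a = 0`, then `d'a` and `d''a` are
`d'd''`-exact. -/
theorem mem_imd'd''_of_bcInjective (h : ∀ k, C.BCInjective k) {p q : ℤ} {a : W}
    (ha : a ∈ C.A p q) (hd : C.d' (C.d'' a) = 0) :
    C.d' a ∈ C.imd'd'' (p + 1) q ∧ C.d'' a ∈ C.imd'd'' p (q + 1) := by
  have hd' : C.d'' (C.d' a) = 0 := by rw [d''_d', hd, neg_zero]
  have key := h (p + q + 1)
    (Finsupp.single (p + 1) (C.d' a) + Finsupp.single p (C.d'' a)) ?_ ?_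
  · have h1 := key (p + 1)
    have h2 := key p
    rw [show p + q + 1 - (p + 1) = q by ring] at h1
    rw [show p + q + 1 - p = q + 1 by ring] at h2
    constructor
    · simpa using h1
    · simpa using h2
  · intro r
    rw [Finsupp.add_apply]
    refine add_mem ?_ ?_
    · by_cases hr : p + 1 = r
      · subst hr
        rw [Finsupp.single_eq_same, show p + q + 1 - (p + 1) = q by ring]
        exact ⟨⟨C.d'_d' a, C.d'_mem ha⟩, hd', C.d'_mem ha⟩
      · rw [Finsupp.single_eq_of_ne' hr]
        exact zero_mem _
    · by_cases hr : p = r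
      · subst hr
        rw [Finsupp.single_eq_same, show p + q + 1 - p = q + 1 by ring]
        exact ⟨⟨hd, C.d''_mem ha⟩, C.d''_d'' a, C.d''_mem ha⟩
      · rw [Finsupp.single_eq_of_ne' hr]
        exact zero_mem _
  · rw [Finsupp.sum_add_index' (fun _ => rfl) (fun _ _ _ => rfl), Finsupp.sum_single_index rfl,
      Finsupp.sum_single_index rfl]
    exact C.dtot_mem_imdTot rfl (C.mem_Atot rfl ha)

theorem ddLemmaAt_of_bcInjective (h : ∀ k, C.BCInjective k) (p q : ℤ) : C.DDLemmaAt p q := by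
  constructor
  · refine le_antisymm ?_ ?_
    · rintro _ ⟨⟨a, ha, rfl⟩, hx, -⟩
      have h0 : C.d' (C.d'' a) = 0 := by
        rw [← neg_eq_zero, ← d''_d']
        exact hx
      have := (mem_imd'd''_of_bcInjective h ha h0).1
      rwa [sub_add_cancel] at this
    · rintro _ ⟨u, hu, rfl⟩
      have hu'' : C.d'' u ∈ C.A (p - 1) q := by simpa using C.d''_mem hu
      refine ⟨⟨C.d'' u, hu'', rfl⟩, ?_, by simpa using C.d'_mem hu''⟩
      change C.d'' (C.d' (C.d'' u)) = 0
      rw [d''_d', d''_d'', map_zero, neg_zero]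
  · refine le_antisymm ?_ ?_
    · rintro _ ⟨⟨hx, -⟩, a, ha, rfl⟩
      have := (mem_imd'd''_of_bcInjective h ha hx).2
      rwa [sub_add_cancel] at this
    · rintro _ ⟨u, hu, rfl⟩
      have hu'' : C.d'' u ∈ C.A (p - 1) q := by simpa using C.d''_mem hu
      have hu' : C.d' u ∈ C.A p (q - 1) := by simpa using C.d'_mem hu
      refine ⟨⟨C.d'_d' _, by simpa using C.d'_mem hu''⟩, -C.d' u, neg_mem hu', ?_⟩
      rw [map_neg, d''_d', neg_neg, LinearMap.comp_apply]

end BiComplex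

/-- Let `(A^{p,q}, d', d'')` be a totally bounded double complex
of complex vector spaces.  If every `H_BC^{p,q}` and every total cohomology
`H^k` is finite dimensional, and `Σ_{p+q=k} dim H_BC^{p,q} = dim H^k` for every
`k`, then the double complex satisfies the `d'd''`-lemma. -/
theorem bicomplex_dim_BC_eq_betti_implies_ddlemma
    {W : Type*} [AddCommGroup W] [Module ℂ W] (C : BiComplex W)
    (hbd : C.TotallyBounded)
    (hBCfin : ∀ p q : ℤ, FiniteDimensional ℂ
      (quotSub (C.kerd' p q ⊓ C.kerd'' p q) (C.imd'd'' p q)))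
    (hHfin : ∀ k : ℤ, FiniteDimensional ℂ (quotSub (C.kerdTot k) (C.imdTot k)))
    (heq : ∀ k : ℤ,
      (∑ᶠ p : ℤ, Module.finrank ℂ
          (quotSub (C.kerd' p (k - p) ⊓ C.kerd'' p (k - p))
            (C.imd'd'' p (k - p)))) =
        Module.finrank ℂ (quotSub (C.kerdTot k) (C.imdTot k))) :
    ∀ p q : ℤ, C.DDLemmaAt p q := by
  obtain ⟨N, hN⟩ := hbd
  refine BiComplex.ddLemmaAt_of_bcInjective fun k => ?_
  have hlarge : ∀ k : ℤ, 2 * (N : ℤ) < k → C.BCInjective k := by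
    intro k hk f hf _ p
    have hA : f p ∈ C.A p (k - p) := (hf p).1.2
    rw [hN p (k - p) (by
      by_contra! hle
      have h1 := le_abs_self p
      have h2 := le_abs_self (k - p)
      omega), mem_bot] at hA
    rw [hA]
    exact zero_mem _
  rcases lt_or_ge (2 * (N : ℤ)) k with hk | hk
  · exact hlarge k hk
  · induction k, (show k ≤ 2 * (N : ℤ) + 1 by omega) using Int.leInductionDown with
    | base => omega
    | pred k _ ih =>
      refine BiComplex.BCInjective.of_succ (S := Finset.Icc (-(N : ℤ)) N) ?_ hBCfin (hHfin _)
        (heq _) ?_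
      · intro p hp
        refine hN p _ (Or.inl ?_)
        by_contra! hle
        exact hp (Finset.mem_Icc.2 (abs_le.1 hle))
      · rw [sub_add_cancel]
        rcases lt_or_ge (2 * (N : ℤ)) k with hk' | hk'
        · exact hlarge k hk'
        · exact ih hk'
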